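/- Let $n$ be a positive integer and let $a$ be a real number with $a \le -2$ or $a > 0$. Then $\sum_{k=1}^{\infty} \frac{1}{k^2 (a+1)^k \binom{n+k}{k}} = \mathrm{Li}_2\Big(\frac{1}{a+1}\Big) - \log(1 + 1/a) \sum_{k=1}^{n} \frac{(-a)^k}{k} - H_n^{(2)} - \sum_{k=1}^{n} \frac{(H_k + H_{n-k} - H_n)(-a)^k}{k}$. -/

import Mathlib

/-- The `n`-th harmonic number `H_n = ∑_{k=1}^n 1/k`, with `H_0 = 0`. -/
noncomputable def H (n : ℕ) : ℝ := ∑ i ∈ Finset.range n, (1 : ℝ) / (i + 1)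

/-- The generalized harmonic number of order 2, `H_n^{(2)} = ∑_{k=1}^n 1/k²`. -/
noncomputable def H2 (n : ℕ) : ℝ := ∑ i ∈ Finset.range n, (1 : ℝ) / (i + 1) ^ 2

/-- The dilogarithm function `Li₂(x) = ∑_{k=1}^∞ x^k/k²`. -/
noncomputable def Li2 (x : ℝ) : ℝ := ∑' k : ℕ, x ^ (k + 1) / ((k : ℝ) + 1) ^ 2

open Filter Topology Finset in
lemma log_tendsto_neg_one :
    Tendsto (fun N : ℕ => ∑ i ∈ range N, (-1 : ℝ) ^ (i + 1) / ((i : ℝ) + 1)) atTop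
      (𝓝 (-Real.log 2)) := by
  have hanti : Antitone (fun i : ℕ => 1 / ((i : ℝ) + 1)) := by
    intro i j hij
    have : (i : ℝ) ≤ j := by exact_mod_cast hij
    dsimp only
    gcongr
  obtain ⟨l, hl⟩ := hanti.tendsto_alternating_series_of_tendsto_zero
    tendsto_one_div_add_atTop_nhds_zero_nat
  have hl' : Tendsto (fun N : ℕ => ∑ i ∈ range N, (-1 : ℝ) ^ (i + 1) / ((i : ℝ) + 1)) atTop
      (𝓝 (-l)) := by
    refine hl.neg.congr fun N => ?_
    rw [← Finset.sum_neg_distrib]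
    refine Finset.sum_congr rfl fun i _ => ?_
    rw [pow_succ]; ring
  have hA := Real.tendsto_tsum_powerSeries_nhdsWithin_lt hl'
  have hB : Tendsto (fun z : ℝ => -Real.log (1 + z) / z) (𝓝[<] 1) (𝓝 (-Real.log 2)) := by
    have : ContinuousAt (fun z : ℝ => -Real.log (1 + z) / z) 1 := by
      refine ContinuousAt.div (ContinuousAt.neg (ContinuousAt.log (by fun_prop) (by norm_num)))
        continuousAt_id (by norm_num)
    have h2 := this.tendsto
    norm_num at h2
    exact h2.mono_left nhdsWithin_le_nhds
  have hev : (fun z : ℝ => ∑' n : ℕ, (-1 : ℝ) ^ (n + 1) / ((n : ℝ) + 1) * z ^ n)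
      =ᶠ[𝓝[<] 1] (fun z : ℝ => -Real.log (1 + z) / z) := by
    have : Set.Ioo (0 : ℝ) 1 ∈ 𝓝[<] (1 : ℝ) := Ioo_mem_nhdsLT (by norm_num)
    filter_upwards [this] with z hz
    have h1 := Real.hasSum_pow_div_log_of_abs_lt_one (x := -z)
      (by rw [abs_neg, abs_of_pos hz.1]; exact hz.2)
    have h2 := h1.div_const z
    rw [sub_neg_eq_add] at h2
    rw [← h2.tsum_eq]
    refine tsum_congr fun n => ?_
    have hz0 : z ≠ 0 := hz.1.ne'
    rw [neg_pow z]
    field_simp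
    ring
  have := tendsto_nhds_unique (hA.congr' hev) hB
  rw [this] at hl'
  exact hl'

open Filter Topology Finset in
lemma log_tendsto (x : ℝ) (h1 : -1 ≤ x) (h2 : x < 1) :
    Tendsto (fun N : ℕ => ∑ i ∈ range N, x ^ (i + 1) / ((i : ℝ) + 1)) atTop
      (𝓝 (-Real.log (1 - x))) := by
  rcases h1.eq_or_lt with h | h
  · subst h
    have := log_tendsto_neg_one
    norm_num at this ⊢
    exact this
  · exact (Real.hasSum_pow_div_log_of_abs_lt_one (abs_lt.2 ⟨h, h2⟩)).tendsto_sum_nat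

lemma choose_rel1 (n k : ℕ) : ((k : ℝ) + 1) * ((n + (k + 1)).choose (k + 1) : ℝ) =
    ((n : ℝ) + 1) * ((n + 1 + k).choose k : ℝ) := by
  have h := Nat.choose_succ_right_eq (n + (k + 1)) k
  have e : n + (k + 1) - k = n + 1 := by omega
  rw [e, show n + (k + 1) = n + 1 + k by ring] at h
  rw [show n + (k + 1) = n + 1 + k by ring]
  have h' : (((n + 1 + k).choose (k + 1) : ℕ) : ℝ) * ((k : ℝ) + 1) =
      ((n + 1 + k).choose k : ℝ) * ((n : ℝ) + 1) := by exact_mod_cast h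
  linarith

lemma choose_rel2 (n k : ℕ) : ((k : ℝ) + 1) * ((n + (k + 1)).choose (k + 1) : ℝ) =
    ((n : ℝ) + k + 1) * ((n + k).choose k : ℝ) := by
  have h := Nat.add_one_mul_choose_eq (n + k) k
  have h' : ((n : ℝ) + k + 1) * ((n + k).choose k : ℝ) =
     ((n + (k + 1)).choose (k + 1) : ℝ) * ((k : ℝ) + 1) := by exact_mod_cast h
  linarith

lemma choose_posR (n k : ℕ) : (0 : ℝ) < ((n + k).choose k : ℝ) := by
  exact_mod_cast Nat.choose_pos (Nat.le_add_left k n)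

open Finset in
lemma T_partial (n : ℕ) (a x : ℝ) (hax : a * x = 1 - x) (N : ℕ) :
    ∑ k ∈ range N, x ^ (k + 1) / (((k : ℝ) + 1) * ((n + 1 + (k + 1)).choose (k + 1) : ℝ)) =
    1 / ((n : ℝ) + 1) - x ^ N / (((n : ℝ) + 1) * ((n + 1 + N).choose N : ℝ)) -
    a * ∑ k ∈ range N, x ^ (k + 1) / (((k : ℝ) + 1) * ((n + (k + 1)).choose (k + 1) : ℝ)) := by
  induction N with
  | zero => simp
  | succ N ih =>
    rw [sum_range_succ, ih, sum_range_succ, choose_rel1 n N]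
    have r2 := choose_rel2 (n + 1) N
    have p := choose_posR (n + 1) N
    have q := choose_posR (n + 1) (N + 1)
    push_cast at r2
    set P : ℝ := ((n + 1 + N).choose N : ℝ)
    set Q : ℝ := ((n + 1 + (N + 1)).choose (N + 1) : ℝ)
    have hQ : Q = ((n : ℝ) + 1 + N + 1) * P / ((N : ℝ) + 1) := by
      field_simp; linarith
    have e : a * (x ^ (N + 1) / (((n : ℝ) + 1) * P)) =
        x ^ N * (1 - x) / (((n : ℝ) + 1) * P) := by
      rw [← hax, pow_succ]; ring
    rw [mul_add, e, hQ]
    have : (n : ℝ) + 1 + N + 1 ≠ 0 := by positivity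
    field_simp
    ring

/-- The polynomial part of the auxiliary sum. -/
noncomputable def Qpoly (a : ℝ) (n : ℕ) : ℝ :=
  ∑ k ∈ Finset.range n, (-a) ^ k / ((n : ℝ) - k)

lemma Qpoly_succ (a : ℝ) (n : ℕ) :
    Qpoly a (n + 1) = 1 / ((n : ℝ) + 1) - a * Qpoly a n := by
  unfold Qpoly
  rw [Finset.sum_range_succ', Finset.mul_sum]
  simp only [pow_succ]
  push_cast
  rw [add_comm, sub_eq_add_neg (1 / ((n : ℝ) + 1)), ← Finset.sum_neg_distrib]
  congr 1
  · simp
  · refine Finset.sum_congr rfl fun k _ => ?_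
    rw [add_sub_add_right_eq_sub]; ring

open Filter Topology Finset in
lemma bdry_tendsto (n : ℕ) (x : ℝ) (h1 : -1 ≤ x) (h2 : x < 1) :
    Tendsto (fun N : ℕ => x ^ N / (((n : ℝ) + 1) * ((n + 1 + N).choose N : ℝ))) atTop
      (𝓝 0) := by
  refine squeeze_zero_norm (fun N => ?_) tendsto_one_div_add_atTop_nhds_zero_nat
  rw [norm_div, norm_pow, Real.norm_eq_abs, Real.norm_eq_abs]
  have hx : |x| ≤ 1 := abs_le.2 ⟨h1, h2.le⟩
  have hc : (N : ℝ) + 1 ≤ ((n + 1 + N).choose N : ℝ) := by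
    have : (1 + N).choose N ≤ (n + 1 + N).choose N := Nat.choose_le_choose N (by omega)
    rw [add_comm 1 N, Nat.choose_succ_self_right] at this
    exact_mod_cast this
  have hd : (N : ℝ) + 1 ≤ ((n : ℝ) + 1) * ((n + 1 + N).choose N : ℝ) := by
    have : (0 : ℝ) ≤ n := by positivity
    nlinarith
  rw [abs_of_nonneg (a := _ * _) (by positivity)]
  have := pow_le_one₀ (abs_nonneg x) hx (n := N)
  gcongr

open Filter Topology Finset in
lemma T_tendsto (a x : ℝ) (hax : a * x = 1 - x) (h1 : -1 ≤ x) (h2 : x < 1) (n : ℕ) :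
    Tendsto (fun N : ℕ => ∑ k ∈ range N,
      x ^ (k + 1) / (((k : ℝ) + 1) * ((n + (k + 1)).choose (k + 1) : ℝ))) atTop
      (𝓝 (-Real.log (1 - x) * (-a) ^ n + Qpoly a n)) := by
  induction n with
  | zero => simpa [Qpoly] using log_tendsto x h1 h2
  | succ n ih =>
    have := (((bdry_tendsto n x h1 h2).const_sub (1 / ((n : ℝ) + 1))).sub (ih.const_mul a))
    rw [Qpoly_succ]
    convert this.congr (fun N => (T_partial n a x hax N).symm) using 2
    ring

/-- Right-hand side minus the dilogarithm, negated. -/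
noncomputable def Rpart (a L : ℝ) (n : ℕ) : ℝ :=
  L * (∑ k ∈ Finset.Icc 1 n, (-a) ^ k / (k : ℝ)) +
        H2 n + ∑ k ∈ Finset.Icc 1 n, (H k + H (n - k) - H n) * (-a) ^ k / (k : ℝ)

lemma H_succ (n : ℕ) : H (n + 1) = H n + 1 / ((n : ℝ) + 1) := by
  simp [H, Finset.sum_range_succ]

lemma Rpart_succ (a L : ℝ) (n : ℕ) :
    Rpart a L (n + 1) = Rpart a L n +
      (L * (-a) ^ (n + 1) + Qpoly a (n + 1)) / ((n : ℝ) + 1) := by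
  have hH2 : H2 (n + 1) = H2 n + 1 / ((n : ℝ) + 1) ^ 2 := by
    simp [H2, Finset.sum_range_succ]
  have hQ : Qpoly a (n + 1) = 1 / ((n : ℝ) + 1) +
      ∑ k ∈ Finset.Icc 1 n, (-a) ^ k / ((n : ℝ) + 1 - k) := by
    unfold Qpoly
    rw [Finset.range_eq_Ico, Finset.sum_eq_sum_Ico_succ_bot (Nat.succ_pos n)]
    push_cast
    simp
    rfl
  have hS : ∑ k ∈ Finset.Icc 1 (n + 1), (H k + H (n + 1 - k) - H (n + 1)) * (-a) ^ k / (k : ℝ) =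
      ∑ k ∈ Finset.Icc 1 n, (H k + H (n - k) - H n) * (-a) ^ k / (k : ℝ) +
      (∑ k ∈ Finset.Icc 1 n, (-a) ^ k / ((n : ℝ) + 1 - k)) / ((n : ℝ) + 1) := by
    rw [Finset.sum_Icc_succ_top (by omega), Finset.sum_div, ← Finset.sum_add_distrib]
    have h0 : H 0 = 0 := by simp [H]
    rw [Nat.sub_self, h0]
    simp only [add_zero, sub_self, zero_mul, zero_div]
    refine Finset.sum_congr rfl fun k hk => ?_
    obtain ⟨hk1, hk2⟩ := Finset.mem_Icc.1 hk
    obtain ⟨m, rfl⟩ := Nat.exists_eq_add_of_le hk2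
    rw [show k + m + 1 - k = m + 1 by omega, show k + m - k = m by omega, H_succ, H_succ]
    have hk0 : (k : ℝ) ≠ 0 := by positivity
    push_cast
    rw [show (k : ℝ) + m + 1 - k = m + 1 by ring]
    have : (k : ℝ) + m + 1 ≠ 0 := by positivity
    field_simp
    ring
  unfold Rpart
  rw [hS, hH2, hQ, Finset.sum_Icc_succ_top (by omega)]
  push_cast
  field_simp
  ring

open Finset in
lemma S_term (n k : ℕ) (x : ℝ) :
    x ^ (k + 1) / (((k : ℝ) + 1) ^ 2 * ((n + 1 + (k + 1)).choose (k + 1) : ℝ)) =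
    x ^ (k + 1) / (((k : ℝ) + 1) ^ 2 * ((n + (k + 1)).choose (k + 1) : ℝ)) -
    x ^ (k + 1) / (((k : ℝ) + 1) * ((n + 1 + (k + 1)).choose (k + 1) : ℝ)) / ((n : ℝ) + 1) := by
  have r1 := choose_rel1 n k
  have r2 := choose_rel2 (n + 1) k
  push_cast at r2
  have p := choose_posR (n + 1) k
  set P : ℝ := ((n + 1 + k).choose k : ℝ)
  have h1 : ((n + (k + 1)).choose (k + 1) : ℝ) = ((n : ℝ) + 1) * P / ((k : ℝ) + 1) := by
    field_simp; linarith
  have h2 : ((n + 1 + (k + 1)).choose (k + 1) : ℝ) =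
      ((n : ℝ) + 1 + k + 1) * P / ((k : ℝ) + 1) := by
    field_simp; linarith
  rw [h1, h2]
  have : (n : ℝ) + 1 + k + 1 ≠ 0 := by positivity
  field_simp
  ring

lemma S_summable (x : ℝ) (h1 : -1 ≤ x) (h2 : x < 1) (n : ℕ) :
    Summable (fun k : ℕ =>
      x ^ (k + 1) / (((k : ℝ) + 1) ^ 2 * ((n + (k + 1)).choose (k + 1) : ℝ))) := by
  have hs : Summable (fun k : ℕ => 1 / ((k : ℝ) + 1) ^ 2) := by
    have := (summable_nat_add_iff 1).2 (Real.summable_one_div_nat_pow.2 (one_lt_two))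
    simpa using this
  refine Summable.of_norm_bounded hs fun k => ?_
  have hx : |x| ≤ 1 := abs_le.2 ⟨h1, h2.le⟩
  have hc : (1 : ℝ) ≤ ((n + (k + 1)).choose (k + 1) : ℝ) := by
    exact_mod_cast Nat.choose_pos (Nat.le_add_left (k + 1) n)
  rw [norm_div, norm_pow, Real.norm_eq_abs, Real.norm_eq_abs, abs_of_nonneg (a := _ * _) (by positivity)]
  have := pow_le_one₀ (abs_nonneg x) hx (n := k + 1)
  have h3 : ((k : ℝ) + 1) ^ 2 ≤ ((k : ℝ) + 1) ^ 2 * ((n + (k + 1)).choose (k + 1) : ℝ) :=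
    le_mul_of_one_le_right (by positivity) hc
  gcongr

open Filter Topology Finset in
lemma S_tendsto (a x : ℝ) (hax : a * x = 1 - x) (h1 : -1 ≤ x) (h2 : x < 1) (n : ℕ) :
    Tendsto (fun N : ℕ => ∑ k ∈ range N,
      x ^ (k + 1) / (((k : ℝ) + 1) ^ 2 * ((n + (k + 1)).choose (k + 1) : ℝ))) atTop
      (𝓝 (Li2 x - Rpart a (-Real.log (1 - x)) n)) := by
  induction n with
  | zero =>
    have := (S_summable x h1 h2 0).hasSum.tendsto_sum_nat
    simpa [Rpart, Li2, H2] using this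
  | succ n ih =>
    have := ih.sub ((T_tendsto a x hax h1 h2 (n + 1)).div_const ((n : ℝ) + 1))
    rw [Rpart_succ, ← sub_sub]
    refine this.congr fun N => ?_
    rw [sum_div, ← sum_sub_distrib]
    exact sum_congr rfl fun k _ => (S_term n k x).symm

/-- For `n` a positive integer and real `a` with `a ≤ -2` or `a > 0`,
`∑_{k=1}^∞ 1/(k²(a+1)^k C(n+k,k))
  = Li₂(1/(a+1)) - log(1+1/a) ∑_{k=1}^n (-a)^k/k - H_n^{(2)}
    - ∑_{k=1}^n (H_k + H_{n-k} - H_n)(-a)^k/k`. -/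
theorem inv_binom_sum_eq (n : ℕ) (hn : 0 < n) (a : ℝ) (ha : a ≤ -2 ∨ 0 < a) :
    ∑' k : ℕ,
        1 / (((k : ℝ) + 1) ^ 2 * (a + 1) ^ (k + 1) * (Nat.choose (n + (k + 1)) (k + 1) : ℝ)) =
      Li2 (1 / (a + 1)) - Real.log (1 + 1 / a) * (∑ k ∈ Finset.Icc 1 n, (-a) ^ k / (k : ℝ)) -
        H2 n - ∑ k ∈ Finset.Icc 1 n, (H k + H (n - k) - H n) * (-a) ^ k / (k : ℝ) := by
  have ha0 : a ≠ 0 := by rcases ha with h | h <;> [linarith; exact h.ne']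
  have ha1 : a + 1 ≠ 0 := by
    intro h0
    rcases ha with h | h <;> linarith
  set x : ℝ := 1 / (a + 1) with hx
  have hax : a * x = 1 - x := by rw [hx]; field_simp; ring
  have hb : -1 ≤ x ∧ x < 1 := by
    rcases ha with h | h
    · have h3 : a + 1 < 0 := by linarith
      constructor
      · rw [hx, le_div_iff_of_neg h3]; linarith
      · have : x < 0 := by rw [hx]; exact one_div_neg.2 h3
        linarith
    · have h3 : 0 < a + 1 := by linarith
      constructor
      · have : 0 < x := by rw [hx]; positivity
        linarith
      · rw [hx, div_lt_one h3]; linarith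
  have hlog : Real.log (1 + 1 / a) = -Real.log (1 - x) := by
    rw [← Real.log_inv]
    congr 1
    rw [← hax, hx]
    field_simp
  have key := tendsto_nhds_unique (S_summable x hb.1 hb.2 n).hasSum.tendsto_sum_nat
    (S_tendsto a x hax hb.1 hb.2 n)
  have hl : ∀ k : ℕ, 1 / (((k : ℝ) + 1) ^ 2 * (a + 1) ^ (k + 1) *
      (Nat.choose (n + (k + 1)) (k + 1) : ℝ)) =
      x ^ (k + 1) / (((k : ℝ) + 1) ^ 2 * ((n + (k + 1)).choose (k + 1) : ℝ)) := by
    intro k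
    rw [hx, one_div_pow, div_div]
    congr 1
    ring
  rw [tsum_congr hl, key, hlog, Rpart]
  ring
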